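/- Let x̄ be an asymptotically stable equilibrium of the autonomous system ẋ = f(x, ū), with domain of attraction O. For each compact subset K ⊆ O and each ε > 0, there exist T > 0 and δ > 0 such that, for every ξ ∈ K and every input u defined on [0,∞) with ‖u‖ < δ, the following hold: (a) the solution φ(t, ξ, u) is defined for all t ∈ [0, T]; (b) denoting K̃ = {φ(t, ζ) : t ∈ [0, T], ζ ∈ K}, one has dist(φ(t, ξ, u), K̃) < ε for all t ∈ [0, T]; (c) |φ(T, ξ, u)| < ε. -/

import Mathlib

open MeasureTheory Metric Set Filter Topology

/-- `x` is a (Carathéodory) solution of the control system `ẋ = f(x, u)` on the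
time interval `I` (assumed to contain `0`), staying in the open state space `X`:
`x` is continuous on `I`, takes values in `X`, and satisfies the integral
equation `x t = x 0 + ∫₀ᵗ f (x s) (u s) ds` on `I`. -/
def IsSolOn {n : ℕ} {U : Type*} [MetricSpace U]
    (X : Set (EuclideanSpace ℝ (Fin n)))
    (f : EuclideanSpace ℝ (Fin n) → U → EuclideanSpace ℝ (Fin n))
    (u : ℝ → U) (x : ℝ → EuclideanSpace ℝ (Fin n)) (I : Set ℝ) : Prop :=
  ContinuousOn x I ∧ (∀ t ∈ I, x t ∈ X) ∧
  (∀ t ∈ I, IntervalIntegrable (fun s => f (x s) (u s)) volume 0 t) ∧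
  (∀ t ∈ I, x t = x 0 + ∫ s in (0:ℝ)..t, f (x s) (u s))

/-- `u` is an admissible input on `[0,∞)`: it is (a.e. strongly) measurable and
locally essentially bounded, i.e. on each compact subinterval of `[0,∞)` it
takes values, up to a null set, in a compact subset of `U`. -/
def IsInput {U : Type*} [MetricSpace U] (u : ℝ → U) : Prop :=
  AEStronglyMeasurable u (volume.restrict (Ici (0:ℝ))) ∧
  ∀ I₀ : Set ℝ, IsCompact I₀ → I₀ ⊆ Ici 0 →
    ∃ K₀ : Set U, IsCompact K₀ ∧ ∀ᵐ t ∂(volume.restrict I₀), u t ∈ K₀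

/-- The (essential) sup norm `‖u‖ = ess sup_{t ≥ 0} dist (u t) ubar` is `< δ`. -/
def SupNormLt {U : Type*} [MetricSpace U] (u : ℝ → U) (ubar : U) (δ : ℝ) : Prop :=
  ∃ b, b < δ ∧ ∀ᵐ t ∂(volume.restrict (Ici (0:ℝ))), dist (u t) ubar ≤ b

lemma cics_gron {T a L : ℝ} (hL : 0 < L) (v : ℝ → ℝ) (hv : ContinuousOn v (Icc 0 T))
    (hv0 : ∀ t, 0 ≤ v t)
    (h : ∀ t ∈ Icc 0 T, v t ≤ a + L * ∫ s in (0:ℝ)..t, v s) :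
    ∀ t ∈ Icc 0 T, v t ≤ a * Real.exp (L * t) := by
  intro t ht
  have hT : 0 ≤ T := ht.1.trans ht.2
  have hInt : IntervalIntegrable v volume 0 T := by
    apply ContinuousOn.intervalIntegrable
    rwa [uIcc_of_le hT]
  have hcont : ContinuousOn (fun t => ∫ s in (0:ℝ)..t, v s) (Icc 0 T) := by
    have := intervalIntegral.continuousOn_primitive_interval (μ := volume) (f := v) (a := 0) (b := T)
      (by rw [uIcc_of_le hT]; exact hv.integrableOn_Icc)
    rwa [uIcc_of_le hT] at this
  have key := norm_le_gronwallBound_of_norm_deriv_right_le (f := fun t => ∫ s in (0:ℝ)..t, v s)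
    (f' := v) (δ := 0) (K := L) (ε := a) (a := 0) (b := T) hcont (by
      intro x hx
      have hI : IntervalIntegrable v volume 0 x := by
        apply hInt.mono_set
        rw [uIcc_of_le hT, uIcc_of_le hx.1]
        exact Icc_subset_Icc le_rfl hx.2.le
      have hcx : ContinuousWithinAt v (Ici x) x :=
        (hv x ⟨hx.1, hx.2.le⟩).mono_of_mem_nhdsWithin (by
          apply mem_of_superset (Icc_mem_nhdsGE hx.2)
          exact Icc_subset_Icc hx.1 le_rfl)
      refine intervalIntegral.integral_hasDerivWithinAt_right hI
        (s := Ici x) (t := Ioi x) ?_ (hcx.mono Ioi_subset_Ici_self)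
      refine ⟨Ioo x T, Ioo_mem_nhdsGT hx.2, ?_⟩
      have : ContinuousOn v (Ioo x T) := hv.mono (fun y hy => ⟨hx.1.trans hy.1.le, hy.2.le⟩)
      exact this.aestronglyMeasurable measurableSet_Ioo) (by simp) (by
      intro x hx
      have h1 := h x ⟨hx.1, hx.2.le⟩
      have h2 : 0 ≤ ∫ s in (0:ℝ)..x, v s :=
        intervalIntegral.integral_nonneg hx.1 (fun s _ => hv0 s)
      rw [Real.norm_of_nonneg (hv0 x), Real.norm_of_nonneg h2]
      linarith) t ht
  rw [gronwallBound_of_K_ne_0 hL.ne'] at key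
  have h1 := h t ht
  have h3 := (le_abs_self _).trans key
  have h4 := mul_le_mul_of_nonneg_left h3 hL.le
  have h5 : L * (0 * Real.exp (L * (t - 0)) + a / L * (Real.exp (L * (t - 0)) - 1))
      = a * (Real.exp (L * t) - 1) := by
    field_simp; simp
  rw [h5] at h4
  linarith

lemma cics_exists {E : Type*} [NormedAddCommGroup E] [NormedSpace ℝ E] [CompleteSpace E]
    {T L : ℝ} (hT : 0 ≤ T) (hL : 0 < L) (g : ℝ → E → E) (ξ : E)
    (hInt : ∀ x : ℝ → E, Continuous x → IntegrableOn (fun s => g s (x s)) (Icc 0 T))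
    (hlip : ∀ᵐ s ∂(volume.restrict (Icc 0 T)), ∀ x z, ‖g s x - g s z‖ ≤ L * ‖x - z‖) :
    ∃ y : ℝ → E, Continuous y ∧ y 0 = ξ ∧
      ∀ t ∈ Icc 0 T, y t = ξ + ∫ s in (0:ℝ)..t, g s (y s) := by
  have hII : ∀ x : ℝ → E, Continuous x → ∀ t ∈ Icc 0 T,
      IntervalIntegrable (fun s => g s (x s)) volume 0 t := by
    intro x hx t ht
    rw [intervalIntegrable_iff_integrableOn_Icc_of_le ht.1]
    exact (hInt x hx).mono_set (Icc_subset_Icc le_rfl ht.2)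
  let ex : C(Icc 0 T, E) → ℝ → E := fun v s => Real.exp (2 * L * s) • v (projIcc 0 T hT s)
  have hex : ∀ v, Continuous (ex v) := by
    intro v
    have : Continuous (fun s => projIcc 0 T hT s) := continuous_projIcc
    fun_prop
  let F : C(Icc 0 T, E) → C(Icc 0 T, E) := fun v =>
    ⟨fun t => Real.exp (-(2 * L * t)) • (ξ + ∫ s in (0:ℝ)..t, g s (ex v s)), by
      have h1 := intervalIntegral.continuousOn_primitive_interval (μ := volume)
        (f := fun s => g s (ex v s)) (a := 0) (b := T)
        (by rw [uIcc_of_le hT]; exact hInt _ (hex v))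
      rw [uIcc_of_le hT, continuousOn_iff_continuous_domRestrict] at h1
      have h2 : Continuous (fun t : Icc (0:ℝ) T => ∫ s in (0:ℝ)..t, g s (ex v s)) := h1
      fun_prop⟩
  have hF : ContractingWith (1/2) F := by
    refine ⟨by norm_num, LipschitzWith.of_dist_le_mul fun v w => ?_⟩
    rw [ContinuousMap.dist_le (by positivity)]
    rintro ⟨t, ht⟩
    rw [dist_eq_norm]
    show ‖Real.exp (-(2 * L * t)) • (ξ + ∫ s in (0:ℝ)..t, g s (ex v s)) -
      Real.exp (-(2 * L * t)) • (ξ + ∫ s in (0:ℝ)..t, g s (ex w s))‖ ≤ _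
    rw [← smul_sub, add_sub_add_left_eq_sub, ← intervalIntegral.integral_sub (hII _ (hex v) t ht)
      (hII _ (hex w) t ht), norm_smul, Real.norm_of_nonneg (Real.exp_pos _).le]
    have hae : ∀ᵐ s ∂volume, s ∈ Ioc 0 t → ‖g s (ex v s) - g s (ex w s)‖
        ≤ L * dist v w * Real.exp (2 * L * s) := by
      rw [ae_restrict_iff' measurableSet_Icc] at hlip
      filter_upwards [hlip] with s hs hst
      refine (hs ⟨hst.1.le, hst.2.trans ht.2⟩ _ _).trans ?_
      simp only [ex]
      rw [← smul_sub, norm_smul, Real.norm_of_nonneg (Real.exp_pos _).le, ← dist_eq_norm,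
        show L * dist v w * Real.exp (2 * L * s) = L * (Real.exp (2 * L * s) * dist v w) by ring]
      gcongr
      exact ContinuousMap.dist_apply_le_dist _
    have hb := intervalIntegral.norm_integral_le_of_norm_le ht.1 hae
      (Continuous.intervalIntegrable (by fun_prop) _ _)
    have hI : ∫ s in (0:ℝ)..t, L * dist v w * Real.exp (2 * L * s)
        = dist v w * (Real.exp (2 * L * t) - 1) / 2 := by
      rw [intervalIntegral.integral_const_mul, intervalIntegral.integral_comp_mul_left _ (by positivity)]
      simp
      field_simp
    rw [hI] at hb
    have he : Real.exp (-(2 * L * t)) * Real.exp (2 * L * t) = 1 := by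
      rw [← Real.exp_add]; simp
    calc _ ≤ Real.exp (-(2 * L * t)) * (dist v w * (Real.exp (2 * L * t) - 1) / 2) := by gcongr
      _ = dist v w * (1 - Real.exp (-(2 * L * t))) / 2 := by
        linear_combination dist v w / 2 * he
      _ ≤ _ := by
        push_cast
        nlinarith [Real.exp_pos (-(2 * L * t)), dist_nonneg (x := v) (y := w),
          mul_nonneg (dist_nonneg (x := v) (y := w)) (Real.exp_pos (-(2 * L * t))).le]
  have hne : Nonempty C(Icc 0 T, E) := ⟨0⟩
  have hfix := hF.fixedPoint_isFixedPt
  set v := ContractingWith.fixedPoint F hF with hv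
  have hsol : ∀ t ∈ Icc 0 T, ex v t = ξ + ∫ s in (0:ℝ)..t, g s (ex v s) := by
    intro t ht
    have h1 : F v ⟨t, ht⟩ = v ⟨t, ht⟩ := by rw [hfix]
    have h2 : ex v t = Real.exp (2 * L * t) • v ⟨t, ht⟩ := by
      simp only [ex]; rw [projIcc_of_mem hT ht]
    rw [h2, ← h1]
    show Real.exp (2 * L * t) • Real.exp (-(2 * L * t)) • (ξ + ∫ s in (0:ℝ)..t, g s (ex v s)) = _
    rw [smul_smul, ← Real.exp_add]; simp
  exact ⟨ex v, hex v, by simpa using hsol 0 ⟨le_rfl, hT⟩, hsol⟩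

lemma cics_lip {E U : Type*} [NormedAddCommGroup E] [MetricSpace U] {X : Set E} {f : E → U → E}
    (hfc : ContinuousOn (fun p : E × U => f p.1 p.2) (X ×ˢ (univ : Set U)))
    (hflip : ∀ ξ ∈ X, ∀ K₀ : Set U, IsCompact K₀ → ∃ V ∈ 𝓝 ξ, ∃ L : ℝ,
      ∀ x ∈ V, ∀ z ∈ V, ∀ μ ∈ K₀, ‖f x μ - f z μ‖ ≤ L * ‖x - z‖)
    {Q : Set E} (hQ : IsCompact Q) (hQX : Q ⊆ X) {K₀ : Set U} (hK : IsCompact K₀) :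
    ∃ M ≥ 0, ∃ L ≥ 0, (∀ x ∈ Q, ∀ μ ∈ K₀, ‖f x μ‖ ≤ M) ∧
      ∀ x ∈ Q, ∀ z ∈ Q, ∀ μ ∈ K₀, ‖f x μ - f z μ‖ ≤ L * ‖x - z‖ := by
  obtain ⟨M, hM⟩ := (hQ.prod hK).exists_bound_of_continuousOn
    (hfc.mono (prod_mono hQX (subset_univ _)))
  have hM' : ∀ x ∈ Q, ∀ μ ∈ K₀, ‖f x μ‖ ≤ max M 0 := fun x hx μ hμ =>
    (hM (x, μ) ⟨hx, hμ⟩).trans (le_max_left _ _)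
  refine ⟨max M 0, le_max_right _ _, ?_⟩
  have := (hQ.prod hQ).induction_on
    (p := fun s => ∃ L ≥ 0, ∀ q ∈ s, q ∈ Q ×ˢ Q → ∀ μ ∈ K₀, ‖f q.1 μ - f q.2 μ‖ ≤ L * ‖q.1 - q.2‖)
    ⟨0, le_rfl, by simp⟩
    (fun s t hst ⟨L, h0, hL⟩ => ⟨L, h0, fun q hq => hL q (hst hq)⟩)
    (fun s t ⟨L, h0, hL⟩ ⟨L', h0', hL'⟩ => ⟨L + L', by positivity, by
      rintro q (hq | hq) hqQ μ hμ
      · refine (hL q hq hqQ μ hμ).trans ?_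
        gcongr; linarith
      · refine (hL' q hq hqQ μ hμ).trans ?_
        gcongr; linarith⟩)
    (by
      rintro ⟨x, z⟩ ⟨hx, hz⟩
      by_cases hxz : x = z
      · subst hxz
        obtain ⟨V, hV, L, hL⟩ := hflip x (hQX hx) K₀ hK
        refine ⟨V ×ˢ V, mem_nhdsWithin_of_mem_nhds (prod_mem_nhds hV hV), max L 0,
          le_max_right _ _, ?_⟩
        rintro ⟨a, b⟩ ⟨ha, hb⟩ _ μ hμ
        refine (hL a ha b hb μ hμ).trans ?_
        gcongr; exact le_max_left _ _
      · have hd : 0 < ‖x - z‖ := by rw [norm_pos_iff]; exact sub_ne_zero.2 hxz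
        have hopen : ∀ᶠ q : E × E in 𝓝 (x, z), ‖x - z‖ / 2 < ‖q.1 - q.2‖ := by
          have hc : ContinuousAt (fun q : E × E => ‖q.1 - q.2‖) (x, z) := by fun_prop
          exact hc.eventually (lt_mem_nhds (by simp only; linarith))
        refine ⟨_, mem_nhdsWithin_of_mem_nhds hopen, 4 * max M 0 / ‖x - z‖, by positivity, ?_⟩
        rintro ⟨a, b⟩ hab ⟨ha, hb⟩ μ hμ
        have hab' : ‖x - z‖ / 2 < ‖a - b‖ := hab
        have h0 : 0 ≤ max M 0 := le_max_right _ _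
        calc ‖f a μ - f b μ‖ ≤ max M 0 + max M 0 :=
              (norm_sub_le _ _).trans (add_le_add (hM' a ha μ hμ) (hM' b hb μ hμ))
          _ = 4 * max M 0 / ‖x - z‖ * (‖x - z‖ / 2) := by field_simp; ring
          _ ≤ _ := by gcongr)
  obtain ⟨L, h0, hL⟩ := this
  exact ⟨L, h0, hM', fun x hx z hz μ hμ => hL (x, z) ⟨hx, hz⟩ ⟨hx, hz⟩ μ hμ⟩

lemma cics_unif {E U : Type*} [NormedAddCommGroup E] [MetricSpace U] {X : Set E} {f : E → U → E}
    (hfc : ContinuousOn (fun p : E × U => f p.1 p.2) (X ×ˢ (univ : Set U)))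
    {Q : Set E} (hQ : IsCompact Q) (hQX : Q ⊆ X) (ubar : U) {η : ℝ} (hη : 0 < η) :
    ∃ δ > 0, ∀ x ∈ Q, ∀ μ, dist μ ubar < δ → ‖f x μ - f x ubar‖ ≤ η := by
  refine hQ.induction_on
    (p := fun s => ∃ δ > 0, ∀ x ∈ s, ∀ μ, dist μ ubar < δ → ‖f x μ - f x ubar‖ ≤ η)
    ⟨1, one_pos, by simp⟩
    (fun s t hst ⟨L, h0, hL⟩ => ⟨L, h0, fun q hq => hL q (hst hq)⟩)
    (fun s t ⟨L, h0, hL⟩ ⟨L', h0', hL'⟩ => ⟨min L L', by positivity, by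
      rintro q (hq | hq) μ hμ
      · exact hL q hq μ (hμ.trans_le (min_le_left _ _))
      · exact hL' q hq μ (hμ.trans_le (min_le_right _ _))⟩) ?_
  intro x hx
  have hc := Metric.continuousWithinAt_iff.1 (hfc (x, ubar) ⟨hQX hx, mem_univ _⟩) (η / 2) (by positivity)
  obtain ⟨δ, hδ, h⟩ := hc
  refine ⟨ball x δ ∩ Q, by rw [inter_comm]; exact inter_mem_nhdsWithin _ (ball_mem_nhds _ hδ), δ, hδ, ?_⟩
  rintro y ⟨hy, hyQ⟩ μ hμ
  have h1 := h (x := (y, μ)) ⟨hQX hyQ, mem_univ _⟩ (by rw [Prod.dist_eq]; exact max_lt hy hμ)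
  have h2 := h (x := (y, ubar)) ⟨hQX hyQ, mem_univ _⟩
    (by rw [Prod.dist_eq]; exact max_lt hy (by simpa using hδ))
  rw [← dist_eq_norm]
  have := dist_triangle_right (f y μ) (f y ubar) (f x ubar)
  simp only at h1 h2
  linarith

lemma cics_cutoff {E U : Type*} [NormedAddCommGroup E] [NormedSpace ℝ E] [ProperSpace E]
    [MetricSpace U] {X : Set E} {f : E → U → E} (hX : IsOpen X)
    (hfc : ContinuousOn (fun p : E × U => f p.1 p.2) (X ×ˢ (univ : Set U)))
    (hflip : ∀ ξ ∈ X, ∀ K₀ : Set U, IsCompact K₀ → ∃ V ∈ 𝓝 ξ, ∃ L : ℝ,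
      ∀ x ∈ V, ∀ z ∈ V, ∀ μ ∈ K₀, ‖f x μ - f z μ‖ ≤ L * ‖x - z‖)
    {S : Set E} (hS : IsCompact S) (hSX : S ⊆ X) (hSne : S.Nonempty) (ubar : U) :
    ∃ r > 0, ∃ G : E → U → E, Continuous (fun p : E × U => G p.1 p.2) ∧
      (∀ x, infDist x S ≤ r → x ∈ X ∧ ∀ μ, G x μ = f x μ) ∧
      (∀ K₀ : Set U, IsCompact K₀ → ∃ L > 0, ∀ x z, ∀ μ ∈ K₀,
        ‖G x μ - G z μ‖ ≤ L * ‖x - z‖) ∧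
      (∀ η > 0, ∃ δ > 0, ∀ x μ, dist μ ubar < δ → ‖G x μ - G x ubar‖ ≤ η) := by
  obtain ⟨r2, hr2, hQX⟩ := hS.exists_cthickening_subset_open hX hSX
  obtain ⟨r, rfl⟩ : ∃ r, r2 = 2 * r := ⟨r2 / 2, by ring⟩
  have hr : 0 < r := by linarith
  set Q := cthickening (2 * r) S with hQdef
  have hQ : IsCompact Q := hS.cthickening
  have hmemQ : ∀ x, infDist x S ≤ 2 * r → x ∈ Q := fun x hx => by
    obtain ⟨s, hs, hd⟩ := hS.exists_infDist_eq_dist hSne x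
    exact mem_cthickening_of_dist_le x s _ _ hs (hd ▸ hx)
  let χ : E → ℝ := fun x => max 0 (min 1 (2 - infDist x S / r))
  have hχc : Continuous χ := by
    have := continuous_infDist_pt S
    fun_prop
  have hχ0 : ∀ x, 0 ≤ χ x := fun x => le_max_left _ _
  have hχ1 : ∀ x, χ x ≤ 1 := fun x => max_le zero_le_one (min_le_left _ _)
  have hχlip : ∀ x z, |χ x - χ z| ≤ ‖x - z‖ / r := by
    intro x z
    calc |χ x - χ z| ≤ |min 1 (2 - infDist x S / r) - min 1 (2 - infDist z S / r)| := by
          have := abs_max_sub_max_le_abs (min 1 (2 - infDist x S / r)) (min 1 (2 - infDist z S / r)) 0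
          simpa only [χ, max_comm] using this
      _ ≤ |(2 - infDist x S / r) - (2 - infDist z S / r)| := by
          have := abs_min_sub_min_le_max 1 (2 - infDist x S / r) 1 (2 - infDist z S / r)
          simpa using this
      _ = |infDist x S - infDist z S| / r := by
          rw [show (2 - infDist x S / r) - (2 - infDist z S / r)
            = -((infDist x S - infDist z S) / r) by ring, abs_neg, abs_div, abs_of_pos hr]
      _ ≤ _ := by
          gcongr
          rw [← dist_eq_norm, abs_le]
          constructor
          · have := infDist_le_infDist_add_dist (s := S) (x := z) (y := x)
            rw [dist_comm] at this; linarith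
          · have := infDist_le_infDist_add_dist (s := S) (x := x) (y := z)
            linarith
  have hχout : ∀ x, x ∉ Q → χ x = 0 := by
    intro x hx
    have : 2 * r < infDist x S := by
      by_contra h; exact hx (hmemQ x (not_lt.1 h))
    have : 2 < infDist x S / r := by rwa [lt_div_iff₀ hr]
    apply max_eq_left
    exact (min_le_right _ _).trans (by linarith)
  have hχin : ∀ x, infDist x S ≤ r → χ x = 1 := by
    intro x hx
    have : infDist x S / r ≤ 1 := by rwa [div_le_one hr]
    simp only [χ]
    rw [min_eq_left (by linarith)]; simp
  refine ⟨r, hr, fun x μ => χ x • f x μ, ?_, ?_, ?_, ?_⟩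
  · rw [continuous_iff_continuousAt]
    rintro ⟨x, μ⟩
    by_cases hx : x ∈ X
    · have h1 : ContinuousAt (fun p : E × U => f p.1 p.2) (x, μ) :=
        hfc.continuousAt (prod_mem_nhds (hX.mem_nhds hx) univ_mem)
      have h2 : ContinuousAt (fun p : E × U => χ p.1) (x, μ) := by fun_prop
      exact h2.smul h1
    · have hxQ : x ∈ Qᶜ := fun h => hx (hQX h)
      have : (fun p : E × U => χ p.1 • f p.1 p.2) =ᶠ[𝓝 (x, μ)] fun _ => 0 := by
        filter_upwards [prod_mem_nhds (hQ.isClosed.isOpen_compl.mem_nhds hxQ) univ_mem] with p hp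
        rw [hχout _ hp.1, zero_smul]
      exact continuousAt_const.congr this.symm
  · intro x hx
    exact ⟨hQX (hmemQ x (by linarith)), fun μ => by simp [hχin x hx]⟩
  · intro K₀ hK
    obtain ⟨M, hM0, L, hL0, hM, hL⟩ := cics_lip hfc hflip hQ hQX hK
    have hout : ∀ x z, z ∉ Q → ∀ μ ∈ K₀, ‖χ x • f x μ‖ ≤ M / r * ‖x - z‖ := by
      intro x z hz μ hμ
      by_cases hx : x ∈ Q
      · have := hχlip x z
        rw [hχout z hz, sub_zero] at this
        rw [norm_smul, Real.norm_eq_abs]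
        calc _ ≤ ‖x - z‖ / r * M := by gcongr; exact hM x hx μ hμ
          _ = _ := by ring
      · rw [hχout x hx, zero_smul, norm_zero]; positivity
    refine ⟨L + M / r + 1, by positivity, ?_⟩
    intro x z μ hμ
    have hle : M / r * ‖x - z‖ ≤ (L + M / r + 1) * ‖x - z‖ := by
      gcongr; linarith
    by_cases hz : z ∈ Q
    · by_cases hx : x ∈ Q
      · have h1 : χ x • f x μ - χ z • f z μ = χ x • (f x μ - f z μ) + (χ x - χ z) • f z μ := by
          rw [smul_sub, sub_smul]; abel
        simp only
        rw [h1]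
        refine (norm_add_le _ _).trans ?_
        rw [norm_smul, norm_smul, Real.norm_eq_abs, Real.norm_eq_abs, abs_of_nonneg (hχ0 x)]
        calc _ ≤ 1 * (L * ‖x - z‖) + ‖x - z‖ / r * M := by
              gcongr
              · exact hχ1 x
              · exact hL x hx z hz μ hμ
              · exact hχlip x z
              · exact hM z hz μ hμ
          _ = (L + M / r) * ‖x - z‖ := by ring
          _ ≤ _ := mul_le_mul_of_nonneg_right (by linarith) (norm_nonneg _)
      · have := hout z x hx μ hμ
        simp only
        rw [hχout x hx, zero_smul, zero_sub, norm_neg]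
        rw [norm_sub_rev] at this
        linarith
    · have := hout x z hz μ hμ
      simp only
      rw [hχout z hz, zero_smul, sub_zero]
      linarith
  · intro η hη
    obtain ⟨δ, hδ, h⟩ := cics_unif hfc hQ hQX ubar hη
    refine ⟨δ, hδ, fun x μ hμ => ?_⟩
    simp only
    by_cases hx : x ∈ Q
    · rw [← smul_sub, norm_smul, Real.norm_eq_abs, abs_of_nonneg (hχ0 x)]
      calc _ ≤ 1 * η := by
            gcongr
            · exact hχ1 x
            · exact h x hx μ hμ
        _ = η := one_mul _
    · rw [hχout x hx]; simpa using hη.le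

lemma cics_key {n : ℕ} {U : Type*} [MetricSpace U]
    (X : Set (EuclideanSpace ℝ (Fin n)))
    (f : EuclideanSpace ℝ (Fin n) → U → EuclideanSpace ℝ (Fin n)) (ubar : U)
    (hX : IsOpen X)
    (hfc : ContinuousOn (fun p : EuclideanSpace ℝ (Fin n) × U => f p.1 p.2)
      (X ×ˢ (univ : Set U)))
    (hflip : ∀ ξ ∈ X, ∀ K₀ : Set U, IsCompact K₀ → ∃ V ∈ 𝓝 ξ, ∃ L : ℝ,
      ∀ x ∈ V, ∀ z ∈ V, ∀ μ ∈ K₀, ‖f x μ - f z μ‖ ≤ L * ‖x - z‖)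
    {T ε : ℝ} (hT : 0 ≤ T) (hε : 0 < ε) (φ : ℝ → EuclideanSpace ℝ (Fin n))
    (hφ : IsSolOn X f (fun _ => ubar) φ (Ici 0)) :
    ∃ ρ > 0, ∃ δ > 0, ∀ ξ, dist ξ (φ 0) < ρ → ∀ u : ℝ → U, IsInput u → SupNormLt u ubar δ →
      ∃ y, IsSolOn X f u y (Icc 0 T) ∧ y 0 = ξ ∧ ∀ t ∈ Icc (0:ℝ) T, dist (y t) (φ t) < ε := by
  obtain ⟨hφc, hφX, hφi, hφe⟩ := hφ
  have hsub : Icc 0 T ⊆ Ici (0:ℝ) := fun t ht => ht.1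
  have hφcT : ContinuousOn φ (Icc 0 T) := hφc.mono hsub
  have hS : IsCompact (φ '' Icc 0 T) := isCompact_Icc.image_of_continuousOn hφcT
  obtain ⟨r, hr, G, hGc, hGf, hGlip, hGη⟩ := cics_cutoff hX hfc hflip hS
    (by rintro _ ⟨t, ht, rfl⟩; exact hφX t ht.1) ⟨φ 0, 0, ⟨le_rfl, hT⟩, rfl⟩ ubar
  obtain ⟨L, hL, hLip⟩ := hGlip {ubar} isCompact_singleton
  set m := min r ε with hm
  have hm0 : 0 < m := lt_min hr hε
  set c := m / (2 * (1 + T) * Real.exp (L * T)) with hc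
  have hc0 : 0 < c := by positivity
  obtain ⟨δ, hδ, hGδ⟩ := hGη c hc0
  refine ⟨c, hc0, δ, hδ, fun ξ hξ u hu ⟨b, hb, hub⟩ => ?_⟩
  obtain ⟨K₀, hK₀, hKu⟩ := hu.2 (Icc 0 T) isCompact_Icc hsub
  obtain ⟨Lu, hLu, hLipu⟩ := hGlip K₀ hK₀
  have hmeas : AEStronglyMeasurable u (volume.restrict (Icc 0 T)) :=
    hu.1.mono_measure (Measure.restrict_mono hsub le_rfl)
  have hGint : ∀ x : ℝ → EuclideanSpace ℝ (Fin n), Continuous x →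
      IntegrableOn (fun s => G (x s) (u s)) (Icc 0 T) := by
    intro x hx
    obtain ⟨M, hM⟩ := ((isCompact_Icc (a := (0:ℝ)) (b := T)).image hx |>.prod hK₀).exists_bound_of_continuousOn
      hGc.continuousOn
    have h1 : AEStronglyMeasurable (fun s => G (x s) (u s)) (volume.restrict (Icc 0 T)) :=
      hGc.comp_aestronglyMeasurable (hx.aestronglyMeasurable.prodMk hmeas)
    refine Integrable.of_bound h1 M ?_
    filter_upwards [hKu, ae_restrict_mem measurableSet_Icc] with s hs hsI
    exact hM (x s, u s) ⟨⟨s, hsI, rfl⟩, hs⟩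
  obtain ⟨y, hyc, hy0, hye⟩ := cics_exists hT hLu (fun s x => G x (u s)) ξ hGint (by
    filter_upwards [hKu] with s hs x z using hLipu x z _ hs)
  have hinf0 : ∀ t ∈ Icc 0 T, infDist (φ t) (φ '' Icc 0 T) ≤ r := fun t ht => by
    rw [infDist_zero_of_mem (mem_image_of_mem φ ht)]; exact hr.le
  have hdc : ContinuousOn (fun t => ‖y t - φ t‖) (Icc 0 T) :=
    (hyc.continuousOn.sub hφcT).norm
  have hgr := cics_gron (T := T) (a := c + c * T) hL (fun t => ‖y t - φ t‖) hdc
    (fun t => norm_nonneg _) (by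
      intro t ht
      have hIcc : Icc 0 t ⊆ Icc 0 T := Icc_subset_Icc le_rfl ht.2
      have hi1 : IntervalIntegrable (fun s => G (y s) (u s)) volume 0 t := by
        rw [intervalIntegrable_iff_integrableOn_Icc_of_le ht.1]
        exact (hGint y hyc).mono_set hIcc
      have hid : IntervalIntegrable (fun t => ‖y t - φ t‖) volume 0 t := by
        apply ContinuousOn.intervalIntegrable
        rw [uIcc_of_le ht.1]; exact hdc.mono hIcc
      have heq : y t - φ t = (ξ - φ 0) +
          ∫ s in (0:ℝ)..t, (G (y s) (u s) - f (φ s) ubar) := by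
        rw [intervalIntegral.integral_sub hi1 (hφi t ht.1), hye t ht, hφe t ht.1]
        abel
      have hbd : ‖∫ s in (0:ℝ)..t, (G (y s) (u s) - f (φ s) ubar)‖ ≤
          ∫ s in (0:ℝ)..t, (c + L * ‖y s - φ s‖) := by
        apply intervalIntegral.norm_integral_le_of_norm_le ht.1 _
          (intervalIntegrable_const.add (hid.const_mul L))
        rw [ae_restrict_iff' measurableSet_Ici] at hub
        filter_upwards [hub] with s hs hst
        have h1 := hGδ (y s) (u s) ((hs hst.1.le).trans_lt hb)
        have h2 := hLip (y s) (φ s) ubar rfl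
        rw [(hGf (φ s) (hinf0 s ⟨hst.1.le, hst.2.trans ht.2⟩)).2 ubar] at h2
        have := norm_sub_le_norm_sub_add_norm_sub (G (y s) (u s)) (G (y s) ubar) (f (φ s) ubar)
        linarith
      rw [intervalIntegral.integral_add intervalIntegrable_const (hid.const_mul L),
        intervalIntegral.integral_const, intervalIntegral.integral_const_mul] at hbd
      have h3 : ‖y t - φ t‖ ≤ ‖ξ - φ 0‖ + _ := heq ▸ norm_add_le _ _
      rw [dist_eq_norm] at hξ
      have h4 : (t - 0) • c ≤ c * T := by
        rw [smul_eq_mul, sub_zero, mul_comm]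
        gcongr; exact ht.2
      show ‖y t - φ t‖ ≤ _
      linarith)
  have hclose : ∀ t ∈ Icc 0 T, dist (y t) (φ t) < m := by
    intro t ht
    rw [dist_eq_norm]
    calc _ ≤ (c + c * T) * Real.exp (L * t) := hgr t ht
      _ ≤ (c + c * T) * Real.exp (L * T) := by gcongr; exact ht.2
      _ = m / 2 := by rw [hc]; field_simp
      _ < m := by linarith
  have hyin : ∀ t ∈ Icc 0 T, infDist (y t) (φ '' Icc 0 T) ≤ r := fun t ht =>
    (infDist_le_dist_of_mem (mem_image_of_mem φ ht)).trans ((hclose t ht).le.trans (min_le_left _ _))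
  have hcongr : ∀ t ∈ Icc 0 T, EqOn (fun s => G (y s) (u s)) (fun s => f (y s) (u s)) (uIcc 0 t) := by
    intro t ht s hs
    rw [uIcc_of_le ht.1] at hs
    exact (hGf (y s) (hyin s ⟨hs.1, hs.2.trans ht.2⟩)).2 _
  refine ⟨y, ⟨hyc.continuousOn, fun t ht => (hGf _ (hyin t ht)).1, ?_, ?_⟩, hy0,
    fun t ht => (hclose t ht).trans_le (min_le_right _ _)⟩
  · intro t ht
    have hi1 : IntervalIntegrable (fun s => G (y s) (u s)) volume 0 t := by
      rw [intervalIntegrable_iff_integrableOn_Icc_of_le ht.1]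
      exact (hGint y hyc).mono_set (Icc_subset_Icc le_rfl ht.2)
    exact hi1.congr ((hcongr t ht).mono uIoc_subset_uIcc)
  · intro t ht
    rw [hy0, hye t ht, intervalIntegral.integral_congr (hcongr t ht)]

lemma cics_concat {n : ℕ} {U : Type*} [MetricSpace U]
    (X : Set (EuclideanSpace ℝ (Fin n)))
    (f : EuclideanSpace ℝ (Fin n) → U → EuclideanSpace ℝ (Fin n)) (ubar : U)
    {T : ℝ} (hT : 0 ≤ T) (y z : ℝ → EuclideanSpace ℝ (Fin n))
    (hy : IsSolOn X f (fun _ => ubar) y (Icc 0 T))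
    (hz : IsSolOn X f (fun _ => ubar) z (Ici 0)) (hyz : z 0 = y T) :
    ∃ w, IsSolOn X f (fun _ => ubar) w (Ici 0) ∧ w 0 = y 0 ∧ ∀ t ≥ T, w t = z (t - T) := by
  obtain ⟨hyc, hyX, hyi, hye⟩ := hy
  obtain ⟨hzc, hzX, hzi, hze⟩ := hz
  let w : ℝ → EuclideanSpace ℝ (Fin n) := fun t => if t ≤ T then y t else z (t - T)
  have hw1 : ∀ t ≤ T, w t = y t := fun t ht => if_pos ht
  have hw2 : ∀ t ≥ T, w t = z (t - T) := by
    intro t ht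
    rcases eq_or_lt_of_le ht with h | h
    · subst h; rw [hw1 T le_rfl, sub_self, hyz]
    · exact if_neg (not_le.2 h)
  have hi1 : ∀ t ∈ Icc 0 T, IntervalIntegrable (fun s => f (w s) ubar) volume 0 t := by
    intro t ht
    refine (hyi t ht).congr ?_
    intro s hs
    rw [uIoc_of_le ht.1] at hs
    simp only
    rw [hw1 s (hs.2.trans ht.2)]
  have he1 : ∀ t ∈ Icc 0 T, w t = w 0 + ∫ s in (0:ℝ)..t, f (w s) ubar := by
    intro t ht
    rw [hw1 t ht.2, hw1 0 hT, hye t ht]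
    congr 1
    apply intervalIntegral.integral_congr
    intro s hs
    rw [uIcc_of_le ht.1] at hs
    simp only
    rw [hw1 s (hs.2.trans ht.2)]
  have hi2 : ∀ t ≥ T, IntervalIntegrable (fun s => f (w s) ubar) volume T t := by
    intro t ht
    have h := (hzi (t - T) (sub_nonneg.2 ht)).comp_sub_right T
    simp only [zero_add, sub_add_cancel] at h
    refine h.congr ?_
    intro s hs
    rw [uIoc_of_le ht] at hs
    simp only
    rw [hw2 s hs.1.le]
  have he2 : ∀ t ≥ T, w t = w T + ∫ s in T..t, f (w s) ubar := by
    intro t ht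
    have h : ∫ s in T..t, f (w s) ubar = ∫ s in T..t, f (z (s - T)) ubar := by
      apply intervalIntegral.integral_congr
      intro s hs
      rw [uIcc_of_le ht] at hs
      simp only
      rw [hw2 s hs.1]
    rw [h, intervalIntegral.integral_comp_sub_right (fun s => f (z s) ubar) T, sub_self,
      hw2 t ht, hw2 T le_rfl, sub_self]
    exact hze _ (sub_nonneg.2 ht)
  refine ⟨w, ⟨?_, ?_, ?_, ?_⟩, hw1 0 hT, hw2⟩
  · have h1 : ContinuousOn w (Icc 0 T) := hyc.congr fun t ht => hw1 t ht.2
    have h2 : ContinuousOn w (Ici T) := by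
      have : ContinuousOn (fun t => z (t - T)) (Ici T) :=
        hzc.comp (by fun_prop) (fun t ht => mem_Ici.2 (sub_nonneg.2 ht))
      exact this.congr fun t ht => hw2 t ht
    rw [← Icc_union_Ici_eq_Ici hT]
    exact h1.union_of_isClosed h2 isClosed_Icc isClosed_Ici
  · intro t ht
    rcases le_total t T with h | h
    · rw [hw1 t h]; exact hyX t ⟨ht, h⟩
    · rw [hw2 t h]; exact hzX _ (sub_nonneg.2 h)
  · intro t ht
    rcases le_total t T with h | h
    · exact hi1 t ⟨ht, h⟩
    · exact (hi1 T ⟨hT, le_rfl⟩).trans (hi2 t h)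
  · intro t ht
    rcases le_total t T with h | h
    · exact he1 t ⟨ht, h⟩
    · rw [he2 t h, he1 T ⟨hT, le_rfl⟩, add_assoc,
        intervalIntegral.integral_add_adjacent_intervals (hi1 T ⟨hT, le_rfl⟩) (hi2 t h)]

/-- **Lemma 2.3.** For each compact `K ⊆ O` and each `ε > 0` there exist
`T > 0` and `δ > 0` such that for every `ξ ∈ K` and every input `u` with
`‖u‖ < δ`: (a) `φ(t, ξ, u)` is defined on `[0, T]`; (b) it stays `ε`-close to
the compact `K̃ = {φ(s, ζ) : s ∈ [0, T], ζ ∈ K}`; (c) `|φ(T, ξ, u)| < ε`. -/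
theorem cics_reachability_lemma {n : ℕ} {U : Type*} [MetricSpace U]
    (X : Set (EuclideanSpace ℝ (Fin n)))
    (f : EuclideanSpace ℝ (Fin n) → U → EuclideanSpace ℝ (Fin n))
    (xbar : EuclideanSpace ℝ (Fin n)) (ubar : U)
    (O : Set (EuclideanSpace ℝ (Fin n)))
    -- the state space is open, contains the equilibrium, and `f(x̄, ū) = 0`
    (hX : IsOpen X) (hxbar : xbar ∈ X) (heq : f xbar ubar = 0)
    -- `f` is continuous, and locally Lipschitz in `x` uniformly on compacts of `U`
    (hfc : ContinuousOn (fun p : EuclideanSpace ℝ (Fin n) × U => f p.1 p.2)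
      (X ×ˢ (univ : Set U)))
    (hflip : ∀ ξ ∈ X, ∀ K₀ : Set U, IsCompact K₀ → ∃ V ∈ 𝓝 ξ, ∃ L : ℝ,
      ∀ x ∈ V, ∀ z ∈ V, ∀ μ ∈ K₀, ‖f x μ - f z μ‖ ≤ L * ‖x - z‖)
    -- `x̄` is a stable equilibrium of `ẋ = f(x, ū)` ...
    (hstab : ∀ ε > 0, ∃ δ > 0, ∀ ξ ∈ X, dist ξ xbar ≤ δ →
      ∃ y, IsSolOn X f (fun _ => ubar) y (Ici 0) ∧ y 0 = ξ ∧
        ∀ t ≥ (0:ℝ), dist (y t) xbar < ε)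
    -- ... whose domain of attraction is `O`, a neighborhood of `x̄`
    (hO : O = {ξ | ∃ y, IsSolOn X f (fun _ => ubar) y (Ici 0) ∧ y 0 = ξ ∧
      Tendsto y atTop (𝓝 xbar)})
    (hOnhd : O ∈ 𝓝 xbar) :
    ∀ K : Set (EuclideanSpace ℝ (Fin n)), IsCompact K → K ⊆ O →
    ∀ ε > (0:ℝ), ∃ T > (0:ℝ), ∃ δ > (0:ℝ),
      ∀ ξ ∈ K, ∀ u : ℝ → U, IsInput u → SupNormLt u ubar δ →
        ∃ y, IsSolOn X f u y (Icc 0 T) ∧ y 0 = ξ ∧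
          (∀ t ∈ Icc (0:ℝ) T,
            infDist (y t) {p | ∃ ζ ∈ K, ∃ s ∈ Icc (0:ℝ) T, ∃ z,
              IsSolOn X f (fun _ => ubar) z (Ici 0) ∧ z 0 = ζ ∧ z s = p} < ε) ∧
          dist (y T) xbar < ε := by
  intro K hK hKO ε hε
  -- uniform settling time
  have step1 : ∃ T > (0:ℝ), ∀ ξ ∈ K, ∃ w, IsSolOn X f (fun _ => ubar) w (Ici 0) ∧ w 0 = ξ ∧
      ∀ t ≥ T, dist (w t) xbar < ε / 2 := by
    obtain ⟨d, hd, hdst⟩ := hstab (ε / 2) (by positivity)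
    refine hK.induction_on (p := fun s => ∃ T > (0:ℝ), ∀ ξ ∈ s,
        ∃ w, IsSolOn X f (fun _ => ubar) w (Ici 0) ∧ w 0 = ξ ∧ ∀ t ≥ T, dist (w t) xbar < ε / 2)
      ⟨1, one_pos, by simp⟩
      (fun s t hst ⟨T, h0, h⟩ => ⟨T, h0, fun ξ hξ => h ξ (hst hξ)⟩)
      (fun s t ⟨T, h0, h⟩ ⟨T', h0', h'⟩ => ⟨max T T', lt_max_of_lt_left h0, ?_⟩) ?_
    · rintro ξ (hξ | hξ)
      · obtain ⟨w, h1, h2, h3⟩ := h ξ hξ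
        exact ⟨w, h1, h2, fun t ht => h3 t ((le_max_left _ _).trans ht)⟩
      · obtain ⟨w, h1, h2, h3⟩ := h' ξ hξ
        exact ⟨w, h1, h2, fun t ht => h3 t ((le_max_right _ _).trans ht)⟩
    · intro ξ₀ hξ₀
      have hmem := hKO hξ₀
      rw [hO] at hmem
      obtain ⟨φ, hφ, hφ0, hφlim⟩ := hmem
      obtain ⟨T, hTd, hT1⟩ := (((Metric.tendsto_nhds.1 hφlim) (d / 2) (by positivity)).and
        (eventually_ge_atTop 1)).exists
      have hT0 : 0 < T := by linarith
      obtain ⟨ρ, hρ, δ, hδ, hkey⟩ := cics_key X f ubar hX hfc hflip hT0.le (half_pos hd) φ hφ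
      refine ⟨ball ξ₀ ρ, mem_nhdsWithin_of_mem_nhds (ball_mem_nhds _ hρ), T, hT0, ?_⟩
      intro ξ hξ
      obtain ⟨y, hy, hy0, hyd⟩ := hkey ξ (by rw [hφ0]; exact hξ) (fun _ => ubar)
        ⟨aestronglyMeasurable_const, fun I₀ _ _ => ⟨{ubar}, isCompact_singleton, by simp⟩⟩
        ⟨0, hδ, by simp⟩
      have hTm : T ∈ Icc 0 T := ⟨hT0.le, le_rfl⟩
      obtain ⟨z, hz, hz0, hzd⟩ := hdst (y T) (hy.2.1 T hTm) (by
        have := dist_triangle (y T) (φ T) xbar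
        have := hyd T hTm
        linarith)
      obtain ⟨w, hw, hw0, hwt⟩ := cics_concat X f ubar hT0.le y z hy hz hz0
      exact ⟨w, hw, hw0.trans hy0, fun t ht => by
        rw [hwt t ht]; exact hzd _ (sub_nonneg.2 ht)⟩
  obtain ⟨T, hT, hstep⟩ := step1
  refine ⟨T, hT, ?_⟩
  set Kt := {p | ∃ ζ ∈ K, ∃ s ∈ Icc (0:ℝ) T, ∃ z,
              IsSolOn X f (fun _ => ubar) z (Ici 0) ∧ z 0 = ζ ∧ z s = p} with hKt
  refine hK.induction_on (p := fun S => ∃ δ > (0:ℝ),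
      ∀ ξ ∈ S, ∀ u : ℝ → U, IsInput u → SupNormLt u ubar δ →
        ∃ y, IsSolOn X f u y (Icc 0 T) ∧ y 0 = ξ ∧
          (∀ t ∈ Icc (0:ℝ) T, infDist (y t) Kt < ε) ∧ dist (y T) xbar < ε)
      ⟨1, one_pos, by simp⟩
      (fun s t hst ⟨δ, h0, h⟩ => ⟨δ, h0, fun ξ hξ => h ξ (hst hξ)⟩)
      (fun s t ⟨δ, h0, h⟩ ⟨δ', h0', h'⟩ => ⟨min δ δ', lt_min h0 h0', ?_⟩) ?_
  · rintro ξ (hξ | hξ) u hu ⟨b, hb, hub⟩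
    · exact h ξ hξ u hu ⟨b, hb.trans_le (min_le_left _ _), hub⟩
    · exact h' ξ hξ u hu ⟨b, hb.trans_le (min_le_right _ _), hub⟩
  · intro ξ₀ hξ₀
    obtain ⟨φ, hφ, hφ0, hφT⟩ := hstep ξ₀ hξ₀
    obtain ⟨ρ, hρ, δ, hδ, hkey⟩ := cics_key X f ubar hX hfc hflip hT.le (half_pos hε) φ hφ
    refine ⟨ball ξ₀ ρ, mem_nhdsWithin_of_mem_nhds (ball_mem_nhds _ hρ), δ, hδ, ?_⟩
    intro ξ hξ u hu hud
    obtain ⟨y, hy, hy0, hyd⟩ := hkey ξ (by rw [hφ0]; exact hξ) u hu hud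
    refine ⟨y, hy, hy0, fun t ht => ?_, ?_⟩
    · have hm : φ t ∈ Kt := ⟨ξ₀, hξ₀, t, ht, φ, hφ, hφ0, rfl⟩
      have := infDist_le_dist_of_mem (x := y t) hm
      have := hyd t ht
      linarith
    · have := dist_triangle (y T) (φ T) xbar
      have := hyd T ⟨hT.le, le_rfl⟩
      have := hφT T le_rfl
      linarith
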